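/- Let P be a simple logic program and let M be an extended answer set of P. Then the reduct P_M is maximal with respect to set inclusion among the reducts of founded interpretations of P, i.e. there is no founded interpretation N of P with P_M ⊊ P_N. -/

import Mathlib

namespace ASP

/-- A literal is an atom `a` or a negated atom `¬ a`. -/
inductive Lit (α : Type) : Type where
  | pos (a : α)
  | neg (a : α)
deriving DecidableEq

/-- Classical negation of a literal. -/
def Lit.negate {α : Type} : Lit α → Lit α
  | .pos a => .neg a
  | .neg a => .pos a

/-- The atom underlying a literal. -/
def Lit.atom {α : Type} : Lit α → α
  | .pos a => a
  | .neg a => a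

/-- A rule of a simple logic program: a head which is a literal or absent
(a constraint), and a finite set of literals as body. -/
structure Rule (α : Type) [DecidableEq α] : Type where
  head : Option (Lit α)
  body : Finset (Lit α)

variable {α : Type} [DecidableEq α]

/-- A set of literals is consistent if it contains no complementary pair. -/
def Consistent (I : Set (Lit α)) : Prop :=
  ∀ a : α, ¬(Lit.pos a ∈ I ∧ Lit.neg a ∈ I)

/-- The Herbrand base of a program: all atoms occurring in it. -/
def herbrand (P : Set (Rule α)) : Set α :=
  {a | ∃ r ∈ P, (∃ l, r.head = some l ∧ l.atom = a) ∨ (∃ l ∈ r.body, l.atom = a)}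

/-- An interpretation of `P`: a consistent set of literals over the Herbrand base of `P`. -/
def IsInterp (P : Set (Rule α)) (I : Set (Lit α)) : Prop :=
  Consistent I ∧ ∀ l ∈ I, l.atom ∈ herbrand P

/-- A rule `a ← β` is satisfied by `I` if `a ∈ I` whenever `β ⊆ I`;
a constraint `← β` is satisfied if its body is not contained in `I`. -/
def Satisfied (I : Set (Lit α)) (r : Rule α) : Prop :=
  ↑r.body ⊆ I → ∃ l, r.head = some l ∧ l ∈ I

/-- A rule is applied w.r.t. `I` if its body holds and its head literal is in `I`. -/
def Applied (I : Set (Lit α)) (r : Rule α) : Prop :=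
  ↑r.body ⊆ I ∧ ∃ l, r.head = some l ∧ l ∈ I

/-- A rule `a ← β` is defeated w.r.t. `P` and `I` iff `P` contains an applied
competing rule `¬a ← β'`. -/
def Defeated (P : Set (Rule α)) (I : Set (Lit α)) (r : Rule α) : Prop :=
  ∃ l, r.head = some l ∧ ∃ r' ∈ P, r'.head = some l.negate ∧ Applied I r'

/-- The reduct of `P` w.r.t. `I`: the rules of `P` satisfied by `I`. -/
def reduct (P : Set (Rule α)) (I : Set (Lit α)) : Set (Rule α) :=
  {r ∈ P | Satisfied I r}

/-- `star R` is the unique minimal model of `R` viewed as a positive program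
(negative literals treated as fresh atoms; constraints never fire their head). -/
def star (R : Set (Rule α)) : Set (Lit α) :=
  ⋂₀ {J : Set (Lit α) | ∀ r ∈ R, ↑r.body ⊆ J → ∀ l, r.head = some l → l ∈ J}

/-- An interpretation is founded iff `(P_I)* = I`. -/
def Founded (P : Set (Rule α)) (I : Set (Lit α)) : Prop :=
  star (reduct P I) = I

/-- A founded interpretation `M` is an extended answer set of `P` iff every rule
of `P` is satisfied or defeated w.r.t. `M`. -/
def ExtAnswerSet (P : Set (Rule α)) (M : Set (Lit α)) : Prop :=
  IsInterp P M ∧ Founded P M ∧ ∀ r ∈ P, Satisfied M r ∨ Defeated P M r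

/-- An answer set of a program without negation as failure: a minimal
interpretation satisfying all rules of the program. -/
def IsAnswerSet (P : Set (Rule α)) (M : Set (Lit α)) : Prop :=
  IsInterp P M ∧ (∀ r ∈ P, Satisfied M r) ∧
    ∀ J, IsInterp P J → (∀ r ∈ P, Satisfied J r) → ¬J ⊂ M


/-- The minimal model of a positive program is monotone in the program. -/
theorem star_mono {R S : Set (Rule α)} (h : R ⊆ S) : star R ⊆ star S :=
  Set.sInter_subset_sInter fun _ hJ r hr => hJ r (h hr)

/-- A consistent set does not contain both a literal and its negation. -/
theorem Consistent.negate_notMem {I : Set (Lit α)} (hI : Consistent I) {l : Lit α}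
    (hl : l ∈ I) : l.negate ∉ I := by
  cases l with
  | pos a => exact fun hn => hI a ⟨hl, hn⟩
  | neg a => exact fun hn => hI a ⟨hn, hl⟩

/-- If `M` is an extended answer set of a simple logic program
`P`, then the reduct `P_M` is maximal w.r.t. set inclusion among the reducts of
founded interpretations of `P`. -/
theorem reduct_maximal_of_extAnswerSet
    {α : Type} [DecidableEq α] (P : Set (Rule α)) (hP : P.Countable)
    (M : Set (Lit α)) (hM : ExtAnswerSet P M) :
    ¬∃ N : Set (Lit α), IsInterp P N ∧ Founded P N ∧ reduct P M ⊂ reduct P N := by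
  rintro ⟨N, hN, hNf, hsub, hne⟩
  obtain ⟨-, hMf, hMd⟩ := hM
  have hMN : M ⊆ N := by
    rw [← hMf, ← hNf]
    exact star_mono hsub
  refine hne fun r ⟨hrP, hrN⟩ => ⟨hrP, ?_⟩
  rcases hMd r hrP with h | ⟨l, hl, r', -, hr', -, l', hl', hl'M⟩
  · exact h
  intro hb
  obtain ⟨k, hk, hkN⟩ := hrN (hb.trans hMN)
  obtain rfl : l = k := Option.some.inj (hl.symm.trans hk)
  obtain rfl : l.negate = l' := Option.some.inj (hr'.symm.trans hl')
  exact absurd (hMN hl'M) (hN.1.negate_notMem hkN)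

end ASP
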